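/- For every n ≥ 1, the sequence J_{2n,1}, J_{2n,2}, ..., J_{2n,2n-1} is unimodal; more precisely, J_{2n,k} ≥ J_{2n,k-1} for all 2 ≤ k ≤ n and J_{2n,k} ≥ J_{2n,k+1} for all n ≤ k ≤ 2n-2. -/

import Mathlib

open Finset Polynomial

/-- Number of descents of a permutation of `Fin n`. -/
def desNum {n : ℕ} (π : Equiv.Perm (Fin n)) : ℕ :=
  (Finset.univ.filter fun i : Fin n =>
    ∃ j : Fin n, (j : ℕ) = (i : ℕ) + 1 ∧ π j < π i).card

/-- `invCount n k` is the number of involutions of `{1,…,n}` with exactly `k` descents. -/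
def invCount (n k : ℕ) : ℕ :=
  (Finset.univ.filter fun π : Equiv.Perm (Fin n) => π * π = 1 ∧ desNum π = k).card

/-- `fpfInvCount n k` is the number of fixed-point-free involutions of `{1,…,n}`
with exactly `k` descents. -/
def fpfInvCount (n k : ℕ) : ℕ :=
  (Finset.univ.filter fun π : Equiv.Perm (Fin n) =>
    π * π = 1 ∧ (∀ i, π i ≠ i) ∧ desNum π = k).card


lemma map_perm_univ {N : ℕ} (π : Equiv.Perm (Fin N)) :
    Multiset.map π (univ : Finset (Fin N)).val = univ.val := by
  have := congrArg Finset.val (Finset.map_univ_equiv π)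
  rw [Finset.map_val] at this
  exact this

/-- Lexicographically ordered pairs of letters. -/
abbrev PairL (r : ℕ) := Fin r ×ₗ Fin r

/-- Swap of a lexicographic pair. -/
def swapL {r : ℕ} (p : PairL r) : PairL r := toLex ((ofLex p).2, (ofLex p).1)

/-- Upper pairs. -/
def isUp {r : ℕ} (p : PairL r) : Prop := (ofLex p).1 < (ofLex p).2

instance {r : ℕ} : DecidablePred (isUp (r := r)) := fun p => by unfold isUp; infer_instance

/-- Compatible pairs of a fixed-point-free involution and a word. -/
def compat {N r : ℕ} (π : Equiv.Perm (Fin N)) (w : Fin N → Fin r) : Prop :=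
  ∀ i j : Fin N, (j : ℕ) = (i : ℕ) + 1 → w i ≤ w j ∧ (π j < π i → w i < w j)

instance {N r : ℕ} (π : Equiv.Perm (Fin N)) : DecidablePred (compat (r := r) π) :=
  fun w => by unfold compat; infer_instance

/-- The biword attached to a permutation and a word. -/
def biword {N r : ℕ} (π : Equiv.Perm (Fin N)) (w : Fin N → Fin r) (i : Fin N) : PairL r :=
  toLex (w i, w (π i))

lemma swapL_swapL {r : ℕ} (p : PairL r) : swapL (swapL p) = p := rfl

lemma fin_step_mono {N : ℕ} {α : Type*} [Preorder α] (f : Fin N → α)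
    (h : ∀ i j : Fin N, (j : ℕ) = (i : ℕ) + 1 → f i ≤ f j) : Monotone f := by
  cases N with
  | zero => intro i; exact i.elim0
  | succ N => exact Fin.monotone_iff_le_succ.2 fun i => h _ _ (by simp)

lemma fin_step_strictMono {N : ℕ} {α : Type*} [Preorder α] (f : Fin N → α)
    (h : ∀ i j : Fin N, (j : ℕ) = (i : ℕ) + 1 → f i < f j) : StrictMono f := by
  cases N with
  | zero => intro i; exact i.elim0
  | succ N => exact Fin.strictMono_iff_lt_succ.2 fun i => h _ _ (by simp)

lemma compat.mono {N r : ℕ} {π : Equiv.Perm (Fin N)} {w : Fin N → Fin r} (h : compat π w) :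
    Monotone w := fin_step_mono w fun i j hij => (h i j hij).1

/-- On a block, the permutation is increasing. -/
lemma compat.block {N r : ℕ} {π : Equiv.Perm (Fin N)} {w : Fin N → Fin r} (h : compat π w)
    {i j : Fin N} (hij : i < j) (hw : w i = w j) : π i < π j := by
  have key : ∀ d : ℕ, ∀ i j : Fin N, (j : ℕ) = i + d + 1 → w i = w j → π i < π j := by
    intro d
    induction d with
    | zero =>
      intro i j hij hw
      by_contra hc
      have hne : π i ≠ π j := by
        intro e
        have := π.injective e
        rw [this] at hij; omega
      exact absurd hw ((h i j hij).2 (lt_of_le_of_ne (not_lt.1 hc) hne.symm)).ne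
    | succ d ih =>
      intro i j hij hw
      have hk : (j : ℕ) - 1 < N := by omega
      let k : Fin N := ⟨j - 1, hk⟩
      have h1 : w i ≤ w k := h.mono (Fin.le_def.2 (by simp [k]; omega))
      have h2 : w k ≤ w j := h.mono (Fin.le_def.2 (by simp [k]))
      have e1 : w i = w k := le_antisymm h1 (hw ▸ h2)
      have hkj : (j : ℕ) = (k : ℕ) + 1 := by simp [k]; omega
      have a := ih i k (by simp [k]; omega) e1
      have b : π k < π j := by
        by_contra hc
        have hne : π k ≠ π j := by
          intro e
          have := π.injective e
          rw [this] at hkj; omega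
        have := (h k j hkj).2 (lt_of_le_of_ne (not_lt.1 hc) hne.symm)
        rw [← e1, hw] at this
        exact lt_irrefl _ this
      exact a.trans b
  exact key (j - i - 1) i j (by have := Fin.lt_def.1 hij; omega) hw

section fwd
variable {N r : ℕ} {π : Equiv.Perm (Fin N)} {w : Fin N → Fin r}

lemma biword_mono (h : compat π w) : Monotone (biword π w) := by
  intro i j hij
  rcases hij.eq_or_lt with rfl | hij
  · exact le_rfl
  · unfold biword
    rw [Prod.Lex.toLex_le_toLex']
    exact ⟨h.mono hij.le, fun e => h.mono (h.block hij e).le⟩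

lemma inv_apply_apply (hπ : π * π = 1) (i : Fin N) : π (π i) = i := by
  rw [← Equiv.Perm.mul_apply, hπ]; rfl

lemma swap_biword (hπ : π * π = 1) (i : Fin N) : swapL (biword π w i) = biword π w (π i) := by
  simp [swapL, biword, inv_apply_apply hπ]

lemma biword_offdiag (hπ : π * π = 1) (hf : ∀ i, π i ≠ i) (h : compat π w) (i : Fin N) :
    w i ≠ w (π i) := by
  intro e
  rcases lt_or_gt_of_ne (hf i) with hl | hl
  · have := h.block hl e.symm
    rw [inv_apply_apply hπ] at this
    exact absurd this hl.not_gt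
  · have := h.block hl e
    rw [inv_apply_apply hπ] at this
    exact absurd this hl.not_gt

lemma perm_eq_sort (hπ : π * π = 1) (h : compat π w) :
    π = Tuple.sort (fun i => swapL (biword π w i)) := by
  rw [Tuple.eq_sort_iff]
  refine ⟨?_, ?_⟩
  · have : (fun i => swapL (biword π w i)) ∘ π = biword π w := by
      funext i
      simp [swap_biword hπ, inv_apply_apply hπ]
    rw [this]; exact biword_mono h
  · intro i j hij e
    simp only [swap_biword hπ, inv_apply_apply hπ] at e
    exact h.block hij (congrArg (fun p : PairL r => (ofLex p).1) e)

lemma mset_swap (hπ : π * π = 1) :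
    ((univ : Finset (Fin N)).val.map (biword π w)).map swapL = univ.val.map (biword π w) := by
  rw [Multiset.map_map]
  have : swapL ∘ biword π w = biword π w ∘ π := by
    funext i; exact swap_biword hπ i
  rw [this, ← Multiset.map_map]
  rw [map_perm_univ]

lemma sym_mset_split (S : Multiset (PairL r)) (hs : S.map swapL = S)
    (hd : ∀ p ∈ S, (ofLex p).1 ≠ (ofLex p).2) :
    S = S.filter isUp + (S.filter isUp).map swapL := by
  have h1 : S.filter (fun p => ¬ isUp p) = (S.filter isUp).map swapL := by
    conv_lhs => rw [← hs]
    rw [Multiset.filter_map]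
    congr 1
    apply Multiset.filter_congr
    intro p hp
    have := hd p hp
    simp only [Function.comp, isUp, swapL, ofLex_toLex, not_lt]
    exact ⟨fun h => lt_of_le_of_ne h this, le_of_lt⟩
  rw [← h1, Multiset.filter_add_not]

lemma biword_split (hπ : π * π = 1) (hf : ∀ i, π i ≠ i) (h : compat π w) :
    (univ : Finset (Fin N)).val.map (biword π w) =
      (univ.val.map (biword π w)).filter isUp +
      ((univ.val.map (biword π w)).filter isUp).map swapL := by
  apply sym_mset_split _ (mset_swap hπ)
  intro p hp
  obtain ⟨i, -, rfl⟩ := Multiset.mem_map.1 hp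
  exact biword_offdiag hπ hf h i

end fwd

lemma mono_eq_of_mset {N : ℕ} {α : Type*} [LinearOrder α] {f g : Fin N → α} (hf : Monotone f)
    (hg : Monotone g)
    (h : (univ : Finset (Fin N)).val.map f = univ.val.map g) : f = g := by
  rw [Fin.univ_val_map, Fin.univ_val_map, Multiset.coe_eq_coe] at h
  exact List.ofFn_injective (h.eq_of_pairwise' hf.sortedLE_ofFn.pairwise hg.sortedLE_ofFn.pairwise)

lemma exists_mono_of_mset {N : ℕ} {α : Type*} [LinearOrder α] (S : Multiset α)
    (hS : Multiset.card S = N) :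
    ∃ f : Fin N → α, Monotone f ∧ (univ : Finset (Fin N)).val.map f = S := by
  subst hS
  obtain ⟨l, rfl⟩ : ∃ l : List α, (l : Multiset α) = S := Quot.exists_rep S
  let f : Fin (Multiset.card (l : Multiset α)) → α := fun i => l.get i
  refine ⟨f ∘ Tuple.sort f, Tuple.monotone_sort f, ?_⟩
  rw [← Multiset.map_map]
  rw [map_perm_univ, Fin.univ_val_map]
  have : List.ofFn f = l := List.ofFn_get l
  rw [this]

lemma exists_perm_of_mset {N r : ℕ} (v : Fin N → PairL r) (hv : Monotone v)
    (hs : ((univ : Finset (Fin N)).val.map v).map swapL = univ.val.map v)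
    (hd : ∀ i, (ofLex (v i)).1 ≠ (ofLex (v i)).2) :
    ∃ (π : Equiv.Perm (Fin N)) (w : Fin N → Fin r), π * π = 1 ∧ (∀ i, π i ≠ i) ∧ compat π w ∧
      biword π w = v := by
  let u : Fin N → PairL r := fun i => swapL (v i)
  let π := Tuple.sort u
  obtain ⟨hm, ht⟩ := Tuple.eq_sort_iff.1 (rfl : π = Tuple.sort u)
  have h2 := map_perm_univ π
  have huv : u ∘ π = v := by
    apply mono_eq_of_mset hm hv
    rw [← Multiset.map_map, h2, ← hs, Multiset.map_map]
    rfl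
  have huv' : ∀ i, swapL (v (π i)) = v i := fun i => congrFun huv i
  have hvu : ∀ i, v (π i) = swapL (v i) := fun i => by rw [← huv' i, swapL_swapL]
  have hvi : ∀ i, v (π⁻¹ i) = swapL (v i) := fun i => by
    have := huv' (π⁻¹ i)
    simpa using this.symm
  have ht' : ∀ i j, i < j → v i = v j → π i < π j := fun i j hij e => by
    apply ht i j hij
    simp only [u, hvu, e]
  have hinv : π⁻¹ = π := by
    apply Tuple.eq_sort_iff.2
    constructor
    · have : u ∘ (π⁻¹ : Equiv.Perm (Fin N)) = v := by
        funext i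
        simp only [Function.comp, u, hvi, swapL_swapL]
      rw [this]; exact hv
    · intro i j hij e
      simp only [u, hvi, swapL_swapL] at e
      by_contra hc
      rcases (not_lt.1 hc).eq_or_lt with e2 | hl
      · exact hij.ne (π⁻¹.injective e2.symm)
      · have := ht' _ _ hl (by rw [hvi, hvi, e])
        simp at this
        exact absurd this hij.not_gt
  have hw : ∀ i, (ofLex (v (π i))).1 = (ofLex (v i)).2 := fun i => by rw [hvu]; rfl
  have hwm : Monotone fun i => (ofLex (v i)).1 := fun i j hij => Prod.Lex.monotone_fst _ _ (hv hij)
  refine ⟨π, fun i => (ofLex (v i)).1, ?_, ?_, ?_, ?_⟩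
  · nth_rewrite 1 [← hinv]; simp
  · intro i e
    apply hd i
    rw [← hw i, e]
  · intro i j hij
    have hlt : i < j := Fin.lt_def.2 (by omega)
    refine ⟨hwm hlt.le, fun hdes => ?_⟩
    refine lt_of_le_of_ne (hwm hlt.le) fun e => ?_
    have hle := (Prod.Lex.le_iff'.1 (hv hlt.le)).2 e
    rcases hle.eq_or_lt with e2 | hl
    · have : v i = v j := by
        apply ofLex.injective
        exact Prod.ext e e2
      exact absurd (ht' i j hlt this) hdes.not_gt
    · rw [← hw, ← hw] at hl
      exact absurd (hwm hdes.le) hl.not_ge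
  · funext i
    simp only [biword, hw]
    rfl

/-- The upper pairs as multisets of size `n`. -/
def targetSet (n r : ℕ) : Finset (Multiset (PairL r)) :=
  (univ : Finset (Sym {p : PairL r // isUp p} n)).image fun s => s.1.map Subtype.val

lemma mem_targetSet {n r : ℕ} (T : Multiset (PairL r)) :
    T ∈ targetSet n r ↔ Multiset.card T = n ∧ ∀ p ∈ T, isUp p := by
  unfold targetSet
  simp only [mem_image, mem_univ, true_and]
  constructor
  · rintro ⟨s, rfl⟩
    refine ⟨by rw [Multiset.card_map]; exact s.2, ?_⟩
    intro p hp
    obtain ⟨q, -, rfl⟩ := Multiset.mem_map.1 hp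
    exact q.2
  · rintro ⟨h1, h2⟩
    refine ⟨⟨T.attach.map fun p => ⟨p.1, h2 p.1 p.2⟩, by simpa using h1⟩, ?_⟩
    simp [Multiset.map_map]

lemma card_up (r : ℕ) : Fintype.card {p : PairL r // isUp p} = r.choose 2 := by
  have e : {p : PairL r // isUp p} ≃ Σ b : Fin r, {a : Fin r // a < b} :=
    { toFun := fun p => ⟨(ofLex p.1).2, ⟨(ofLex p.1).1, p.2⟩⟩
      invFun := fun q => ⟨toLex (q.2.1, q.1), q.2.2⟩
      left_inv := fun p => rfl
      right_inv := fun q => rfl }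
  rw [Fintype.card_congr e, Fintype.card_sigma]
  have : ∀ b : Fin r, Fintype.card {a : Fin r // a < b} = (b : ℕ) := by
    intro b
    rw [Fintype.card_subtype]
    have : (univ.filter fun a : Fin r => a < b) = Finset.Iio b := by ext; simp
    rw [this, Fin.card_Iio]
  simp_rw [this]
  rw [Fin.sum_univ_eq_sum_range (fun i => i) r, Finset.sum_range_id, Nat.choose_two_right]

lemma card_targetSet (n r : ℕ) : (targetSet n r).card = (r.choose 2).multichoose n := by
  unfold targetSet
  rw [card_image_of_injective, card_univ, Sym.card_sym_eq_multichoose, card_up]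
  intro s t h
  exact Subtype.ext (Multiset.map_injective Subtype.val_injective h)

/-- All fixed-point-free involutions. -/
def fpfSet (N : ℕ) : Finset (Equiv.Perm (Fin N)) :=
  univ.filter fun π => π * π = 1 ∧ ∀ i, π i ≠ i

lemma card_pairs (n r : ℕ) :
    ∑ π ∈ fpfSet (2 * n), (univ.filter fun w : Fin (2 * n) → Fin r => compat π w).card
      = (r.choose 2).multichoose n := by
  rw [← card_targetSet, ← Finset.card_sigma]
  refine Finset.card_bij
    (fun q _ => ((univ : Finset (Fin (2 * n))).val.map (biword q.1 q.2)).filter isUp) ?_ ?_ ?_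
  · rintro ⟨π, w⟩ hq
    simp only [mem_sigma, fpfSet, mem_filter, mem_univ, true_and] at hq
    obtain ⟨⟨h1, h2⟩, h3⟩ := hq
    rw [mem_targetSet]
    refine ⟨?_, fun p hp => (Multiset.mem_filter.1 hp).2⟩
    have := congrArg Multiset.card (biword_split h1 h2 h3)
    simp only [Multiset.card_add, Multiset.card_map] at this
    have h4 : Multiset.card (univ : Finset (Fin (2 * n))).val = 2 * n := by simp
    dsimp only
    omega
  · rintro ⟨π, w⟩ hq ⟨π', w'⟩ hq' he
    simp only [mem_sigma, fpfSet, mem_filter, mem_univ, true_and] at hq hq' he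
    obtain ⟨⟨h1, h2⟩, h3⟩ := hq
    obtain ⟨⟨h1', h2'⟩, h3'⟩ := hq'
    have hv : biword π w = biword π' w' := by
      apply mono_eq_of_mset (biword_mono h3) (biword_mono h3')
      rw [biword_split h1 h2 h3, biword_split h1' h2' h3', he]
    have hw : w = w' := by
      funext i
      exact congrArg (fun p : PairL r => (ofLex p).1) (congrFun hv i)
    have hp : π = π' := by
      rw [perm_eq_sort h1 h3, perm_eq_sort h1' h3', hv]
    rw [hw, hp]
  · intro T hT
    rw [mem_targetSet] at hT
    obtain ⟨hc, hup⟩ := hT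
    have hss : (T + T.map swapL).map swapL = T + T.map swapL := by
      rw [Multiset.map_add, Multiset.map_map, add_comm]
      congr 1
      exact Multiset.map_id T
    obtain ⟨v, hv, hvS⟩ := exists_mono_of_mset (N := 2 * n) (T + T.map swapL) (by
      simp [hc]; omega)
    obtain ⟨π, w, h1, h2, h3, h4⟩ := exists_perm_of_mset v hv (by rw [hvS, hss]) (by
      intro i
      have : v i ∈ T + T.map swapL := by
        rw [← hvS]; exact Multiset.mem_map_of_mem _ (mem_univ i)
      rcases Multiset.mem_add.1 this with h | h
      · exact (hup _ h).ne
      · obtain ⟨q, hq, e⟩ := Multiset.mem_map.1 h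
        rw [← e]
        exact (hup _ hq).ne')
    refine ⟨⟨π, w⟩, ?_, ?_⟩
    · simp only [mem_sigma, fpfSet, mem_filter, mem_univ, true_and]
      exact ⟨⟨h1, h2⟩, h3⟩
    · simp only [h4, hvS, Multiset.filter_add]
      rw [Multiset.filter_eq_self.2 hup, Multiset.filter_eq_nil.2, add_zero]
      intro p hp
      obtain ⟨q, hq, rfl⟩ := Multiset.mem_map.1 hp
      exact (hup q hq).not_gt

lemma card_strictMono_fin (N M : ℕ) :
    (univ.filter fun f : Fin N → Fin M => StrictMono f).card = M.choose N := by
  classical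
  have h : (Finset.powersetCard N (univ : Finset (Fin M))).card = M.choose N := by
    rw [card_powersetCard, card_univ, Fintype.card_fin]
  rw [← h]
  refine Finset.card_bij (fun f _ => univ.image f) ?_ ?_ ?_
  · intro f hf
    simp only [mem_filter, mem_univ, true_and] at hf
    rw [mem_powersetCard]
    refine ⟨subset_univ _, ?_⟩
    rw [card_image_of_injective _ hf.injective, card_univ, Fintype.card_fin]
  · intro f hf g hg e
    simp only [mem_filter, mem_univ, true_and] at hf hg
    have hr : (univ.image f).card = N := by
      rw [card_image_of_injective _ hf.injective, card_univ, Fintype.card_fin]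
    exact (Finset.orderEmbOfFin_unique hr (fun x => mem_image_of_mem f (mem_univ x)) hf).trans
      (Finset.orderEmbOfFin_unique hr (fun x => e ▸ mem_image_of_mem g (mem_univ x)) hg).symm
  · intro s hs
    rw [mem_powersetCard] at hs
    refine ⟨s.orderEmbOfFin hs.2, ?_, ?_⟩
    · simp only [mem_filter, mem_univ, true_and]
      exact (s.orderEmbOfFin hs.2).strictMono
    · exact Finset.image_orderEmbOfFin_univ s hs.2

/-- Number of elements of `D` below `i`. -/
def cntBelow {N : ℕ} (D : Finset (Fin N)) (i : ℕ) : ℕ := (D.filter fun j : Fin N => (j : ℕ) < i).card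

lemma cntBelow_succ {N : ℕ} (D : Finset (Fin N)) (i : Fin N) :
    cntBelow D ((i : ℕ) + 1) = cntBelow D i + if i ∈ D then 1 else 0 := by
  unfold cntBelow
  split_ifs with h
  · have : D.filter (fun j : Fin N => (j : ℕ) < (i : ℕ) + 1)
        = insert i (D.filter fun j : Fin N => (j : ℕ) < (i : ℕ)) := by
      ext j
      simp only [mem_filter, mem_insert]
      constructor
      · rintro ⟨h1, h2⟩
        by_cases e : j = i
        · exact Or.inl e
        · right
          have : (j : ℕ) ≠ i := fun e' => e (Fin.ext e')
          exact ⟨h1, by omega⟩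
      · rintro (rfl | ⟨h1, h2⟩)
        · exact ⟨h, by omega⟩
        · exact ⟨h1, by omega⟩
    rw [this, card_insert_of_notMem (by simp)]
  · rw [add_zero]
    congr 1
    apply Finset.filter_congr
    intro j hj
    have : (j : ℕ) ≠ i := fun e' => h (Fin.ext e' ▸ hj)
    omega

lemma cntBelow_le {N : ℕ} (D : Finset (Fin N)) (i : ℕ) : cntBelow D i ≤ i := by
  have : cntBelow D i ≤ (Finset.range i).card := by
    unfold cntBelow
    apply Finset.card_le_card_of_injOn Fin.val
    · intro j hj
      simp only [coe_filter, Set.mem_ofPred_eq] at hj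
      simpa using hj.2
    · intro a _ b _ e
      exact Fin.ext e
  simpa using this

/-- The count of `D`-strict weakly increasing words; `D` is a set of indices `i` with `i + 1 < N`. -/
lemma card_words (m r : ℕ) (D : Finset (Fin (m + 1))) (hD : ∀ i ∈ D, (i : ℕ) < m) :
    (univ.filter fun w : Fin (m + 1) → Fin r =>
      ∀ i j : Fin (m + 1), (j : ℕ) = (i : ℕ) + 1 → w i ≤ w j ∧ (i ∈ D → w i < w j)).card
      = (r + m - D.card).choose (m + 1) := by
  rw [← card_strictMono_fin]
  -- bounds on cntBelow
  have hm : cntBelow D m = D.card := by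
    unfold cntBelow
    rw [Finset.filter_true_of_mem hD]
  have hDm : D.card ≤ m := hm ▸ cntBelow_le D m
  -- e i = i - cntBelow i is monotone
  have hcm : ∀ i j : ℕ, i ≤ j → cntBelow D i ≤ cntBelow D j := by
    intro i j hij
    exact Finset.card_le_card (fun x hx => by
      simp only [mem_filter] at hx ⊢; exact ⟨hx.1, by omega⟩)
  have hem : ∀ d i : ℕ, i + d ≤ m → cntBelow D (i + d) ≤ cntBelow D i + d := by
    intro d
    induction d with
    | zero => intro i _; simp
    | succ d ih =>
      intro i hi
      have := ih i (by omega)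
      have h2 := cntBelow_succ D (⟨i + d, by omega⟩ : Fin (m + 1))
      simp only at h2
      rw [← add_assoc, h2]
      split_ifs <;> omega
  have hbd : ∀ i : Fin (m + 1), D.card ≤ cntBelow D i + (m - i) := by
    intro i
    have := hem (m - i) i (by omega)
    rwa [show (i : ℕ) + (m - i) = m by omega, hm] at this
  have hle : ∀ i : Fin (m + 1), cntBelow D i ≤ i := fun i => cntBelow_le D i
  refine Finset.card_bij (fun w _ i => ⟨(w i : ℕ) + (i - cntBelow D i), ?_⟩) ?_ ?_ ?_
  · have := hbd i
    have := hle i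
    have := (w i).2
    have := i.2
    omega
  · intro w hw
    simp only [mem_filter, mem_univ, true_and] at hw ⊢
    apply fin_step_strictMono
    intro i j hij
    obtain ⟨h1, h2⟩ := hw i j hij
    have h3 := cntBelow_succ D i
    have := hle i
    rw [Fin.lt_def]
    simp only
    rw [hij, h3]
    rw [Fin.le_def] at h1
    split_ifs with h
    · have := Fin.lt_def.1 (h2 h); omega
    · omega
  · intro w _ w' _ e
    funext i
    have := congrArg Fin.val (congrFun e i)
    simp only at this
    exact Fin.ext (by omega)
  · intro f hf
    simp only [mem_filter, mem_univ, true_and] at hf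
    have hlow : ∀ i : Fin (m + 1), (i : ℕ) ≤ f i := by
      intro i
      have h : ∀ k : ℕ, ∀ hk : k < m + 1, k ≤ f ⟨k, hk⟩ := by
        intro k
        induction k with
        | zero => intro _; exact Nat.zero_le _
        | succ k ih =>
          intro hk
          have := ih (by omega)
          have h2 : f ⟨k, by omega⟩ < f ⟨k + 1, hk⟩ := hf (Fin.lt_def.2 (by simp))
          rw [Fin.lt_def] at h2
          omega
      exact h i i.2
    have hup : ∀ i : Fin (m + 1), (f i : ℕ) + (m - i) < r + m - D.card := by
      have h : ∀ d : ℕ, ∀ hd : d ≤ m,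
          (f ⟨m - d, by omega⟩ : ℕ) + d < r + m - D.card := by
        intro d
        induction d with
        | zero => intro _; exact (f _).2
        | succ d ih =>
          intro hd
          have := ih (by omega)
          have h2 : f ⟨m - (d + 1), by omega⟩ < f ⟨m - d, by omega⟩ :=
            hf (Fin.lt_def.2 (by simp only; omega))
          rw [Fin.lt_def] at h2
          omega
      intro i
      have := h (m - i) (by omega)
      have e : (⟨m - (m - i), by omega⟩ : Fin (m + 1)) = i := Fin.ext (by simp only; omega)
      rwa [e] at this
    refine ⟨fun i => ⟨(f i : ℕ) - (i - cntBelow D i), ?_⟩, ?_, ?_⟩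
    · have := hup i
      have := hlow i
      have := hle i
      have := hcm i m (by omega)
      omega
    · simp only [mem_filter, mem_univ, true_and]
      intro i j hij
      have h3 := cntBelow_succ D i
      have hfl : f i < f j := hf (Fin.lt_def.2 (by omega))
      rw [Fin.lt_def] at hfl
      have := hlow i
      have := hle i
      have := hlow j
      rw [Fin.le_def, Fin.lt_def]
      simp only
      rw [hij, h3]
      split_ifs with h
      · exact ⟨by omega, fun _ => by omega⟩
      · exact ⟨by omega, fun h' => absurd h' h⟩
    · funext i
      apply Fin.ext
      have := hlow i
      simp only
      omega

lemma desNum_le {m : ℕ} (π : Equiv.Perm (Fin (m + 1))) : desNum π ≤ m := by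
  have : desNum π ≤ (Finset.range m).card := by
    unfold desNum
    apply Finset.card_le_card_of_injOn Fin.val
    · intro i hi
      simp only [coe_filter, mem_univ, true_and, Set.mem_ofPred_eq] at hi
      obtain ⟨j, hj, _⟩ := hi
      have := j.2
      simp only [coe_range, Set.mem_Iio]
      omega
    · intro a _ b _ e
      exact Fin.ext e
  simpa using this

lemma card_compat {m r : ℕ} (π : Equiv.Perm (Fin (m + 1))) :
    (univ.filter fun w : Fin (m + 1) → Fin r => compat π w).card
      = (r + m - desNum π).choose (m + 1) := by
  unfold desNum
  rw [← card_words]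
  · congr 1
    apply Finset.filter_congr
    intro w _
    unfold compat
    simp only [mem_filter, mem_univ, true_and]
    constructor
    · intro h i j hij
      refine ⟨(h i j hij).1, ?_⟩
      rintro ⟨j', hj', hd⟩
      have : j' = j := Fin.ext (by omega)
      exact (h i j hij).2 (this ▸ hd)
    · intro h i j hij
      exact ⟨(h i j hij).1, fun hd => (h i j hij).2 ⟨j, hij, hd⟩⟩
  · intro i hi
    simp only [mem_filter, mem_univ, true_and] at hi
    obtain ⟨j, hj, _⟩ := hi
    have := j.2
    omega

lemma fpf_eq_card (N k : ℕ) : fpfInvCount N k = ((fpfSet N).filter fun π => desNum π = k).card := by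
  unfold fpfInvCount fpfSet
  rw [Finset.filter_filter]
  simp only [and_assoc]

lemma fpf_zero {n k : ℕ} (hk : 2 * (n + 1) ≤ k) : fpfInvCount (2 * (n + 1)) k = 0 := by
  rw [fpf_eq_card, Finset.card_eq_zero, Finset.filter_eq_empty_iff]
  intro π _ h
  have := desNum_le (m := 2 * n + 1) π
  omega

/-- The main counting identity. -/
lemma main_identity (n r : ℕ) :
    ∑ k ∈ range (2 * (n + 1)), fpfInvCount (2 * (n + 1)) k *
      (r + (2 * n + 1) - k).choose (2 * (n + 1)) = (r.choose 2).multichoose (n + 1) := by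
  rw [← card_pairs]
  have h1 : ∀ π ∈ fpfSet (2 * (n + 1)),
      (univ.filter fun w : Fin (2 * (n + 1)) → Fin r => compat π w).card
        = (r + (2 * n + 1) - desNum π).choose (2 * (n + 1)) :=
    fun π _ => card_compat (m := 2 * n + 1) π
  rw [Finset.sum_congr rfl h1]
  rw [← Finset.sum_fiberwise_of_maps_to (s := fpfSet (2 * (n + 1))) (t := range (2 * (n + 1)))
    (g := fun π => desNum π) (fun π _ => by
      have := desNum_le (m := 2 * n + 1) π
      simp only [mem_range]; omega)]
  apply Finset.sum_congr rfl
  intro k _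
  rw [fpf_eq_card, ← smul_eq_mul, ← Finset.sum_const]
  apply Finset.sum_congr rfl
  intro π hπ
  rw [(mem_filter.1 hπ).2]

lemma choose_step (t m : ℕ) :
    ((m : ℤ) + 1) * (t.choose (m + 1) : ℤ) = ((t : ℤ) - m) * (t.choose m : ℤ) := by
  rcases le_or_gt m t with h | h
  · have := Nat.choose_succ_right_eq t m
    zify [h] at this
    linarith
  · rw [Nat.choose_eq_zero_of_lt h, Nat.choose_eq_zero_of_lt (by omega : t < m + 1)]
    simp

lemma choose_prod (t m : ℕ) (k r : ℤ) (hr : r = t - m + 1 + k) :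
    (r * (r - 1) + m) * (t.choose m : ℤ) =
      (k * (k + 1) + m) * ((t + 2).choose (m + 2) : ℤ)
      + 2 * (k * (m - k) + 1) * ((t + 1).choose (m + 2) : ℤ)
      + ((m - k) * (m - k + 1) + m) * (t.choose (m + 2) : ℤ) := by
  have e1 := choose_step t m
  have e2 := choose_step t (m + 1)
  have e3 : ((t + 1).choose (m + 2) : ℤ) = t.choose (m + 1) + t.choose (m + 2) := by
    rw [Nat.choose_succ_succ' t (m + 1)]; push_cast; rfl
  have e4 : ((t + 1).choose (m + 1) : ℤ) = t.choose m + t.choose (m + 1) := by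
    rw [Nat.choose_succ_succ' t m]; push_cast; rfl
  have e5 : ((t + 2).choose (m + 2) : ℤ) = (t + 1).choose (m + 1) + (t + 1).choose (m + 2) := by
    rw [Nat.choose_succ_succ' (t + 1) (m + 1)]; push_cast; rfl
  rw [e5, e4, e3, hr]
  push_cast at e2
  rw [show m + 1 + 1 = m + 2 from rfl] at e2
  linear_combination (-((m : ℤ) + 1)) * e2 - (2 * k + 1 + t - m) * e1

lemma multichoose_step (c n : ℕ) :
    (n + 2) * c.multichoose (n + 2) = (c + n + 1) * c.multichoose (n + 1) := by
  rw [Nat.multichoose_eq, Nat.multichoose_eq]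
  have h := Nat.add_one_mul_choose_eq (c + n) (n + 1)
  rw [show c + (n + 2) - 1 = c + n + 1 by omega, show c + (n + 1) - 1 = c + n by omega]
  rw [show c + n + 1 = c + n + 1 from rfl] at h
  linarith

lemma two_mul_choose_two (r : ℕ) : 2 * (r.choose 2 : ℤ) = r * (r - 1) := by
  have := choose_step r 1
  simp at this
  linarith

lemma choose_indep (N : ℕ) (c : ℕ → ℤ)
    (h : ∀ r : ℕ, ∑ k ∈ range N, c k * ((r + N - 1 - k).choose N : ℤ) = 0) :
    ∀ k, k < N → c k = 0 := by
  intro k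
  induction k using Nat.strong_induction_on with
  | _ k ih =>
    intro hk
    have := h (k + 1)
    rw [Finset.sum_eq_single k] at this
    · rw [show k + 1 + N - 1 - k = N by omega] at this
      simpa using this
    · intro j hj hne
      rw [mem_range] at hj
      rcases lt_or_gt_of_ne hne with hl | hl
      · rw [ih j hl hj, zero_mul]
      · rw [Nat.choose_eq_zero_of_lt (by omega)]; simp
    · intro hn
      exact absurd (mem_range.2 hk) hn

/-- Integer-indexed version. -/
def Xf (n : ℕ) (k : ℤ) : ℤ := if 0 ≤ k then (fpfInvCount (2 * n) k.toNat : ℤ) else 0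

lemma Xf_nat (n k : ℕ) : Xf n (k : ℤ) = fpfInvCount (2 * n) k := by
  simp [Xf]

lemma Xf_neg (n : ℕ) (k : ℤ) (hk : k < 0) : Xf n k = 0 := by
  simp [Xf, hk]

lemma Xf_nonneg (n : ℕ) (k : ℤ) : 0 ≤ Xf n k := by
  unfold Xf; split_ifs <;> simp

lemma Xf_big (n : ℕ) (k : ℤ) (hk : 2 * (n + 1) ≤ k) : Xf (n + 1) k = 0 := by
  obtain ⟨k, rfl⟩ := Int.eq_ofNat_of_zero_le (by omega : 0 ≤ k)
  rw [Xf_nat, fpf_zero (by exact_mod_cast hk)]; rfl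

lemma identity_Xf (n r : ℕ) :
    ∑ k ∈ range (2 * n + 2), Xf (n + 1) k * ((r + (2 * n + 1) - k).choose (2 * n + 2) : ℤ)
      = ((r.choose 2).multichoose (n + 1) : ℤ) := by
  rw [← main_identity n r]
  push_cast
  simp only [Xf_nat]
  rfl

lemma Xf_rec_nat (n k : ℕ) (hk : k < 2 * n + 4) :
    (2 * (n : ℤ) + 4) * Xf (n + 2) k =
      (k * (k + 1) + (2 * n + 2)) * Xf (n + 1) k
      + 2 * ((k - 1) * (2 * n + 3 - k) + 1) * Xf (n + 1) (k - 1)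
      + ((2 * n + 4 - k) * (2 * n + 5 - k) + (2 * n + 2)) * Xf (n + 1) (k - 2) := by
  rw [← sub_eq_zero]
  revert k
  apply choose_indep (2 * n + 4) (fun k : ℕ => (2 * (n : ℤ) + 4) * Xf (n + 2) k -
      ((k * (k + 1) + (2 * n + 2)) * Xf (n + 1) k
      + 2 * ((k - 1) * (2 * n + 3 - k) + 1) * Xf (n + 1) (k - 1)
      + ((2 * n + 4 - k) * (2 * n + 5 - k) + (2 * n + 2)) * Xf (n + 1) (k - 2)))
  intro r
  have hy := identity_Xf (n + 1) r
  have hx := identity_Xf n r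
  have hm : ((n : ℤ) + 2) * ((r.choose 2).multichoose (n + 2) : ℤ)
      = ((r.choose 2 : ℤ) + n + 1) * ((r.choose 2).multichoose (n + 1) : ℤ) := by
    exact_mod_cast multichoose_step (r.choose 2) n
  have h2 := two_mul_choose_two r
  -- the polynomial basis
  let g : ℕ → ℤ := fun k => ((r + (2 * n + 3) - k).choose (2 * n + 4) : ℤ)
  have hg : ∀ k : ℕ, ((r + (2 * n + 4) - 1 - k).choose (2 * n + 4) : ℤ) = g k := fun k => rfl
  have hy' : ∑ k ∈ range (2 * n + 4), Xf (n + 2) k * g k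
      = ((r.choose 2).multichoose (n + 2) : ℤ) := hy
  have hxx : ((r : ℤ) * (r - 1) + (2 * n + 2)) * ((r.choose 2).multichoose (n + 1) : ℤ)
      = ∑ k ∈ range (2 * n + 2), Xf (n + 1) k *
        ((k * (k + 1) + (2 * n + 2)) * g k + 2 * (k * (2 * n + 2 - k) + 1) * g (k + 1)
          + ((2 * n + 2 - k) * (2 * n + 2 - k + 1) + (2 * n + 2)) * g (k + 2)) := by
    rw [← hx, Finset.mul_sum]
    apply Finset.sum_congr rfl
    intro k hk
    rw [mem_range] at hk
    have := choose_prod (r + (2 * n + 1) - k) (2 * n + 2) k r (by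
      rw [Nat.cast_sub (by omega)]; push_cast; ring)
    push_cast at this
    simp only [g]
    rw [show r + (2 * n + 3) - k = r + (2 * n + 1) - k + 2 by omega,
      show r + (2 * n + 3) - (k + 1) = r + (2 * n + 1) - k + 1 by omega,
      show r + (2 * n + 3) - (k + 2) = r + (2 * n + 1) - k by omega,
      show 2 * n + 4 = 2 * n + 2 + 2 by omega]
    rw [← this]
    ring
  have s0 : ∑ k ∈ range (2 * n + 4), (((k : ℤ) * (k + 1) + (2 * n + 2)) * Xf (n + 1) k) * g k
      = ∑ k ∈ range (2 * n + 2), Xf (n + 1) k * ((k * (k + 1) + (2 * n + 2)) * g k) := by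
    rw [Finset.sum_range_succ, Finset.sum_range_succ]
    rw [Xf_big n ((2 * n + 2 : ℕ) : ℤ) (by push_cast; linarith),
      Xf_big n ((2 * n + 2 + 1 : ℕ) : ℤ) (by push_cast; linarith)]
    simp only [mul_zero, zero_mul, add_zero]
    apply Finset.sum_congr rfl
    intro k _
    ring
  have s1 : ∑ k ∈ range (2 * n + 4),
        (2 * (((k : ℤ) - 1) * (2 * n + 3 - k) + 1) * Xf (n + 1) (k - 1)) * g k
      = ∑ k ∈ range (2 * n + 2), Xf (n + 1) k * (2 * (k * (2 * n + 2 - k) + 1) * g (k + 1)) := by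
    rw [Finset.sum_range_succ, Finset.sum_range_succ']
    rw [Xf_neg (n + 1) (((0 : ℕ) : ℤ) - 1) (by norm_num),
      Xf_big n (((2 * n + 3 : ℕ) : ℤ) - 1) (by push_cast; linarith)]
    simp only [mul_zero, zero_mul, add_zero]
    apply Finset.sum_congr rfl
    intro k _
    push_cast
    rw [add_sub_cancel_right]
    ring
  have s2 : ∑ k ∈ range (2 * n + 4),
        (((2 * n + 4 - (k : ℤ)) * (2 * n + 5 - k) + (2 * n + 2)) * Xf (n + 1) (k - 2)) * g k
      = ∑ k ∈ range (2 * n + 2), Xf (n + 1) k *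
        (((2 * n + 2 - k) * (2 * n + 2 - k + 1) + (2 * n + 2)) * g (k + 2)) := by
    rw [Finset.sum_range_succ', Finset.sum_range_succ']
    rw [Xf_neg (n + 1) (((0 : ℕ) : ℤ) - 2) (by norm_num),
      Xf_neg (n + 1) (((0 + 1 : ℕ) : ℤ) - 2) (by norm_num)]
    simp only [mul_zero, zero_mul, add_zero]
    apply Finset.sum_congr rfl
    intro k _
    push_cast
    rw [show (k : ℤ) + 1 + 1 - 2 = k by ring, show k + 1 + 1 = k + 2 from rfl]
    ring
  simp only [hg]
  have split : ∑ k ∈ range (2 * n + 4), ((2 * (n : ℤ) + 4) * Xf (n + 2) k -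
      ((k * (k + 1) + (2 * n + 2)) * Xf (n + 1) k
      + 2 * ((k - 1) * (2 * n + 3 - k) + 1) * Xf (n + 1) (k - 1)
      + ((2 * n + 4 - k) * (2 * n + 5 - k) + (2 * n + 2)) * Xf (n + 1) (k - 2))) * g k
      = (2 * (n : ℤ) + 4) * ∑ k ∈ range (2 * n + 4), Xf (n + 2) k * g k
      - (∑ k ∈ range (2 * n + 4), (((k : ℤ) * (k + 1) + (2 * n + 2)) * Xf (n + 1) k) * g k
        + ∑ k ∈ range (2 * n + 4),
          (2 * (((k : ℤ) - 1) * (2 * n + 3 - k) + 1) * Xf (n + 1) (k - 1)) * g k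
        + ∑ k ∈ range (2 * n + 4),
          (((2 * n + 4 - (k : ℤ)) * (2 * n + 5 - k) + (2 * n + 2)) * Xf (n + 1) (k - 2)) * g k)
      := by
    rw [Finset.mul_sum, ← Finset.sum_add_distrib, ← Finset.sum_add_distrib,
      ← Finset.sum_sub_distrib]
    apply Finset.sum_congr rfl
    intro k _
    ring
  rw [split, hy', s0, s1, s2, ← Finset.sum_add_distrib, ← Finset.sum_add_distrib]
  simp only [← mul_add]
  rw [← hxx]
  linear_combination 2 * hm + ((r.choose 2).multichoose (n + 1) : ℤ) * h2

lemma Xf_rec (n : ℕ) (k : ℤ) :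
    (2 * (n : ℤ) + 4) * Xf (n + 2) k =
      (k * (k + 1) + (2 * n + 2)) * Xf (n + 1) k
      + 2 * ((k - 1) * (2 * n + 3 - k) + 1) * Xf (n + 1) (k - 1)
      + ((2 * n + 4 - k) * (2 * n + 5 - k) + (2 * n + 2)) * Xf (n + 1) (k - 2) := by
  rcases lt_or_ge k 0 with hk | hk
  · rw [Xf_neg _ _ hk, Xf_neg _ _ hk, Xf_neg _ (k - 1) (by omega), Xf_neg _ (k - 2) (by omega)]
    ring
  · rcases lt_or_ge k (2 * n + 4) with h | h
    · obtain ⟨k, rfl⟩ := Int.eq_ofNat_of_zero_le hk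
      exact Xf_rec_nat n k (by omega)
    · rw [Xf_big (n + 1) k (by push_cast; omega), Xf_big n k (by omega),
        Xf_big n (k - 1) (by omega), Xf_big n (k - 2) (by omega)]
      ring

lemma Xf_one (k : ℤ) : Xf 1 k = if k = 1 then 1 else 0 := by
  rcases lt_or_ge k 0 with hk | hk
  · rw [Xf_neg _ _ hk, if_neg (by omega)]
  · rcases lt_or_ge k 2 with h | h
    · have h0 : fpfInvCount (2 * 1) 0 = 0 := by decide
      have h1 : fpfInvCount (2 * 1) 1 = 1 := by decide
      interval_cases k
      · simp [Xf, h0]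
      · simp [Xf, h1]
    · rw [Xf_big 0 k (by push_cast; omega), if_neg (by omega)]

lemma Xf_symm (n : ℕ) : ∀ k : ℤ, Xf (n + 1) (2 * n + 2 - k) = Xf (n + 1) k := by
  induction n with
  | zero =>
    intro k
    rw [zero_add, Xf_one, Xf_one]
    push_cast
    split_ifs <;> omega
  | succ n ih =>
    intro k
    have h1 := Xf_rec n k
    have h2 := Xf_rec n (2 * ((n + 1 : ℕ) : ℤ) + 2 - k)
    have e0 : Xf (n + 1) (2 * ((n + 1 : ℕ) : ℤ) + 2 - k) = Xf (n + 1) (k - 2) := by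
      rw [← ih (k - 2)]; congr 1; push_cast; ring
    have e1 : Xf (n + 1) (2 * ((n + 1 : ℕ) : ℤ) + 2 - k - 1) = Xf (n + 1) (k - 1) := by
      rw [← ih (k - 1)]; congr 1; push_cast; ring
    have e2 : Xf (n + 1) (2 * ((n + 1 : ℕ) : ℤ) + 2 - k - 2) = Xf (n + 1) k := by
      rw [← ih k]; congr 1; push_cast; ring
    rw [e0, e1, e2] at h2
    have hpos : (2 * (n : ℤ) + 4) ≠ 0 := by positivity
    apply mul_left_cancel₀ hpos
    rw [h1, h2]
    push_cast
    ring

lemma Xf_unimodal (n : ℕ) : ∀ k : ℤ, k ≤ n + 1 → Xf (n + 1) (k - 1) ≤ Xf (n + 1) k := by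
  induction n with
  | zero =>
    intro k hk
    rw [zero_add, Xf_one, Xf_one]
    push_cast at hk
    split_ifs <;> omega
  | succ n ih =>
    intro k hk
    push_cast at hk
    rcases le_or_gt k 0 with hk0 | hk0
    · rw [Xf_neg _ (k - 1) (by omega)]; exact Xf_nonneg _ _
    have hpos : 0 < (2 * (n : ℤ) + 4) := by positivity
    apply le_of_mul_le_mul_left _ hpos
    have h1 := Xf_rec n k
    have h2 := Xf_rec n (k - 1)
    rw [show k - 1 - 1 = k - 2 by ring, show k - 1 - 2 = k - 3 by ring] at h2
    have d1 := ih (k - 1) (by omega)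
    have d2 := ih (k - 2) (by omega)
    rw [show k - 1 - 1 = k - 2 by ring] at d1
    rw [show k - 2 - 1 = k - 3 by ring] at d2
    have hC : 0 ≤ (2 * (n : ℤ) + 5 - k) * (2 * n + 6 - k) + (2 * n + 2) := by
      have : 0 ≤ (2 * (n : ℤ) + 5 - k) * (2 * n + 6 - k) :=
        mul_nonneg (by omega) (by omega)
      positivity
    have hp2 := mul_nonneg hC (sub_nonneg.2 d2)
    rcases hk.eq_or_lt with e | hlt
    · -- the central case
      have hs : Xf (n + 1) k = Xf (n + 1) (k - 2) := by
        rw [← Xf_symm n k]; congr 1; rw [e]; ring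
      have hq : 0 ≤ (n : ℤ) * (n - 1) := by
        rcases Nat.eq_zero_or_pos n with h | h
        · simp [h]
        · exact mul_nonneg (by positivity) (by have : (1 : ℤ) ≤ n := by exact_mod_cast h
                                               linarith)
      have hp1 := mul_nonneg hq (sub_nonneg.2 d1)
      rw [h1, h2, hs]
      have ek : (n : ℤ) = k - 2 := by omega
      rw [ek] at hp1 hp2 ⊢
      linarith
    · have d0 := ih k (by omega)
      have hA : 0 ≤ k * (k + 1) + (2 * (n : ℤ) + 2) := by positivity
      have hB : 0 ≤ 2 * k + 2 * ((k - 1) * (2 * (n : ℤ) + 3 - k) + 1) := by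
        have : 0 ≤ (k - 1) * (2 * (n : ℤ) + 3 - k) := mul_nonneg (by omega) (by omega)
        linarith
      have hp0 := mul_nonneg hA (sub_nonneg.2 d0)
      have hp1 := mul_nonneg hB (sub_nonneg.2 d1)
      rw [h1, h2]
      linarith

/-- Unimodality of the sequence `J_{2n,1}, …, J_{2n,2n-1}`. -/
theorem fpfInvCount_unimodal (n : ℕ) (hn : 1 ≤ n) :
    (∀ k, 2 ≤ k → k ≤ n → fpfInvCount (2 * n) (k - 1) ≤ fpfInvCount (2 * n) k) ∧
    (∀ k, n ≤ k → k ≤ 2 * n - 2 → fpfInvCount (2 * n) (k + 1) ≤ fpfInvCount (2 * n) k) := by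
  obtain ⟨n, rfl⟩ : ∃ m, n = m + 1 := ⟨n - 1, by omega⟩
  constructor
  · intro k hk1 hk2
    have := Xf_unimodal n k (by exact_mod_cast hk2)
    rw [show (k : ℤ) - 1 = ((k - 1 : ℕ) : ℤ) by omega, Xf_nat, Xf_nat] at this
    exact_mod_cast this
  · intro k hk1 hk2
    have := Xf_unimodal n (2 * n + 2 - k) (by push_cast at *; omega)
    rw [show 2 * (n : ℤ) + 2 - k - 1 = 2 * n + 2 - ((k + 1 : ℕ) : ℤ) by push_cast; ring,
      Xf_symm, Xf_symm, Xf_nat, Xf_nat] at this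
    exact_mod_cast this
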